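/- Let n ≥ 3, set 2* := 2n/(n−2), and let Θ be a nonempty bounded open subset of ℝⁿ. Let a ∈ C¹(closure Θ) and b, c ∈ C⁰(closure Θ) be strictly positive on closure Θ. Let S := inf{ (∫_{ℝⁿ}|∇u|²dx) / (∫_{ℝⁿ}|u|^{2*}dx)^{2/2*} : u ∈ C_c^∞(ℝⁿ), u ≠ 0 } and κ^{a,c} := (min_{x ∈ closure Θ} a(x)^{n/2}/c(x)^{(n−2)/2})·(1/n)·S^{n/2}. Set λ₁ := inf{ (∫_Θ a|∇u|²dx) / (∫_Θ b u²dx) : u ∈ C_c^∞(Θ), u ≠ 0 }, and for λ < λ₁ set ℓ_λ := inf{ (1/n)·( (∫_Θ a|∇u|²dx − λ∫_Θ b u²dx) / (∫_Θ c|u|^{2*}dx)^{2/2*} )^{n/2} : u ∈ C_c^∞(Θ), u ≠ 0 }. Then for every λ < λ₁ one has 0 < ℓ_λ ≤ κ^{a,c}, and the function λ ↦ ℓ_λ is nonincreasing on (−∞, λ₁), i.e. ℓ_μ ≤ ℓ_λ whenever λ ≤ μ < λ₁. -/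

import Mathlib

open MeasureTheory

noncomputable section

/-- `u ∈ C_c^∞(s)`: `u` is smooth with compact support contained in `s`. -/
def IsTestFun {E : Type*} [NormedAddCommGroup E] [NormedSpace ℝ E]
    (s : Set E) (u : E → ℝ) : Prop :=
  ContDiff ℝ (⊤ : ℕ∞) u ∧ HasCompactSupport u ∧ tsupport u ⊆ s

/-- The best Sobolev constant
`S = inf{ ∫|∇u|² / (∫|u|^{2*})^{2/2*} : u ∈ C_c^∞(ℝⁿ), u ≠ 0 }` with `2* = 2n/(n−2)`. -/
def SobolevS (n : ℕ) : ℝ :=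
  sInf { r : ℝ | ∃ u : EuclideanSpace ℝ (Fin n) → ℝ,
    IsTestFun Set.univ u ∧ u ≠ 0 ∧
    r = (∫ x, ‖gradient u x‖ ^ 2) /
        (∫ x, |u x| ^ (2 * (n : ℝ) / ((n : ℝ) - 2))) ^ (2 / (2 * (n : ℝ) / ((n : ℝ) - 2))) }

lemma aux_norm_grad {n : ℕ} (u : EuclideanSpace ℝ (Fin n) → ℝ) (x : EuclideanSpace ℝ (Fin n)) :
    ‖gradient u x‖ = ‖fderiv ℝ u x‖ := by
  unfold gradient
  exact LinearIsometryEquiv.norm_map _ _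

lemma aux_weight {n : ℕ} {Θ : Set (EuclideanSpace ℝ (Fin n))} (hΘo : IsOpen Θ)
    (hΘb : Bornology.IsBounded Θ) {w g : EuclideanSpace ℝ (Fin n) → ℝ}
    (hw : ContinuousOn w (closure Θ)) (hg : Continuous g) (hg0 : ∀ x, 0 ≤ g x)
    (hgs : ∀ x ∉ Θ, g x = 0) :
    (∀ M : ℝ, (∀ x ∈ Θ, g x ≠ 0 → w x ≤ M) → ∫ x in Θ, w x * g x ≤ M * ∫ x, g x) ∧
    (∀ m : ℝ, (∀ x ∈ Θ, g x ≠ 0 → m ≤ w x) → m * ∫ x, g x ≤ ∫ x in Θ, w x * g x) := by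
  have hK : IsCompact (closure Θ) := hΘb.isCompact_closure
  have hi1 : IntegrableOn (fun x => w x * g x) Θ :=
    ((hw.mul hg.continuousOn).integrableOn_compact hK).mono_set subset_closure
  have hi2 : ∀ M : ℝ, IntegrableOn (fun x => M * g x) Θ := fun M =>
    ((continuous_const.mul hg).continuousOn.integrableOn_compact hK).mono_set subset_closure
  have he : ∀ M : ℝ, M * ∫ x, g x = ∫ x in Θ, M * g x := by
    intro M
    rw [integral_const_mul, setIntegral_eq_integral_of_forall_compl_eq_zero hgs]
  refine ⟨fun M h => ?_, fun m h => ?_⟩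
  · rw [he]
    refine setIntegral_mono_on hi1 (hi2 M) hΘo.measurableSet fun x hx => ?_
    by_cases h0 : g x = 0
    · simp [h0]
    · exact mul_le_mul_of_nonneg_right (h x hx h0) (hg0 x)
  · rw [he]
    refine setIntegral_mono_on (hi2 m) hi1 hΘo.measurableSet fun x hx => ?_
    by_cases h0 : g x = 0
    · simp [h0]
    · exact mul_le_mul_of_nonneg_right (h x hx h0) (hg0 x)

lemma aux_grad {n : ℕ} {s : Set (EuclideanSpace ℝ (Fin n))} {u : EuclideanSpace ℝ (Fin n) → ℝ}
    (hu : IsTestFun s u) : Continuous (fun x => ‖gradient u x‖ ^ 2) ∧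
      (∀ x ∉ tsupport u, ‖gradient u x‖ ^ 2 = 0) := by
  simp_rw [aux_norm_grad]
  refine ⟨((hu.1.continuous_fderiv (by simp)).norm.pow 2), fun x hx => ?_⟩
  have : fderiv ℝ u x = 0 := by
    by_contra h
    exact hx (support_fderiv_subset ℝ h)
  simp [this]

lemma aux_sq {n : ℕ} {s : Set (EuclideanSpace ℝ (Fin n))} {u : EuclideanSpace ℝ (Fin n) → ℝ}
    (hu : IsTestFun s u) : Continuous (fun x => u x ^ 2) ∧
      (∀ x ∉ tsupport u, u x ^ 2 = 0) := by
  refine ⟨hu.1.continuous.pow 2, fun x hx => ?_⟩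
  simp [image_eq_zero_of_notMem_tsupport hx]

lemma aux_pow {n : ℕ} {s : Set (EuclideanSpace ℝ (Fin n))} {u : EuclideanSpace ℝ (Fin n) → ℝ}
    (hu : IsTestFun s u) {p : ℝ} (hp : 0 < p) : Continuous (fun x => |u x| ^ p) ∧
      (∀ x ∉ tsupport u, |u x| ^ p = 0) := by
  refine ⟨hu.1.continuous.abs.rpow_const fun x => Or.inr hp.le, fun x hx => ?_⟩
  simp [image_eq_zero_of_notMem_tsupport hx, Real.zero_rpow hp.ne']

lemma aux_int_pos {n : ℕ} {s : Set (EuclideanSpace ℝ (Fin n))} {u : EuclideanSpace ℝ (Fin n) → ℝ}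
    (hu : IsTestFun s u) (hu0 : u ≠ 0) {p : ℝ} (hp : 0 < p) :
    0 < (∫ x, u x ^ 2) ∧ 0 < ∫ x, |u x| ^ p := by
  obtain ⟨x, hx⟩ := Function.ne_iff.1 hu0
  constructor
  · refine (aux_sq hu).1.integral_pos_of_hasCompactSupport_nonneg_nonzero
      (HasCompactSupport.intro hu.2.1 (aux_sq hu).2) (fun x => sq_nonneg _) (x := x) ?_
    exact pow_ne_zero 2 hx
  · refine (aux_pow hu hp).1.integral_pos_of_hasCompactSupport_nonneg_nonzero
      (HasCompactSupport.intro hu.2.1 (aux_pow hu hp).2) (fun x => by positivity) (x := x) ?_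
    exact (Real.rpow_pos_of_pos (abs_pos.2 hx) p).ne'

lemma aux_sobolev (n : ℕ) (hn : 3 ≤ n) (p : ℝ) (hp : p = 2 * (n : ℝ) / ((n : ℝ) - 2)) :
    ∃ K : ℝ, 0 < K ∧ ∀ u : EuclideanSpace ℝ (Fin n) → ℝ, IsTestFun Set.univ u →
      K * (∫ x, |u x| ^ p) ^ (2 / p) ≤ ∫ x, ‖gradient u x‖ ^ 2 := by
  have hn' : (3 : ℝ) ≤ n := by exact_mod_cast hn
  have hp0 : 0 < p := by rw [hp]; apply div_pos <;> linarith
  obtain ⟨q, hq⟩ : ∃ q : NNReal, (q : ℝ) = p := ⟨⟨p, hp0.le⟩, rfl⟩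
  set C : ℝ := (eLpNormLESNormFDerivOfEqInnerConst
    (volume : Measure (EuclideanSpace ℝ (Fin n))) ((2 : NNReal) : ℝ) : ℝ) with hC
  have hC0 : 0 ≤ C := NNReal.coe_nonneg _
  refine ⟨1 / (C ^ 2 + 1), by positivity, fun u hu => ?_⟩
  have hu1 : ContDiff ℝ 1 u := hu.1.of_le (by simp)
  have key := eLpNorm_le_eLpNorm_fderiv_of_eq_inner (F' := ℝ)
    (volume : Measure (EuclideanSpace ℝ (Fin n))) hu1 hu.2.1 (p := 2) (p' := q)
    (by norm_num) (by simp; omega) (by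
      have : ((n : ℝ) - 2) ≠ 0 := by linarith
      have : (n : ℝ) ≠ 0 := by linarith
      simp [hq, hp]; field_simp)
  have hm1 : MemLp u (q : ENNReal) (volume : Measure (EuclideanSpace ℝ (Fin n))) :=
    hu.1.continuous.memLp_of_hasCompactSupport hu.2.1
  have hm2 : MemLp (fderiv ℝ u) ((2 : NNReal) : ENNReal) (volume : Measure (EuclideanSpace ℝ (Fin n))) :=
    (hu1.continuous_fderiv (by simp)).memLp_of_hasCompactSupport (hu.2.1.fderiv ℝ)
  rw [hm1.eLpNorm_eq_integral_rpow_norm (by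
      simp only [ne_eq, ENNReal.coe_eq_zero]
      intro h; exact hp0.ne' (by rw [← hq, h]; rfl)) (by simp),
    hm2.eLpNorm_eq_integral_rpow_norm (by simp) (by simp)] at key
  simp only [ENNReal.coe_toReal, hq, NNReal.coe_ofNat, Real.norm_eq_abs, Real.rpow_ofNat] at key
  simp_rw [aux_norm_grad]
  set P := ∫ x, |u x| ^ p with hP
  set G := ∫ x, ‖fderiv ℝ u x‖ ^ 2 with hG
  have hP0 : 0 ≤ P := integral_nonneg fun x => by positivity
  have hG0 : 0 ≤ G := integral_nonneg fun x => by positivity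
  rw [← ENNReal.ofReal_coe_nnreal, ← ENNReal.ofReal_mul (NNReal.coe_nonneg _),
    ENNReal.ofReal_le_ofReal_iff (by positivity)] at key
  have h2 : P ^ (2 / p) ≤ C ^ 2 * G := by
    have e1 : P ^ (2 / p) = (P ^ p⁻¹) ^ 2 := by
      rw [← Real.rpow_natCast, ← Real.rpow_mul hP0]; congr 1; push_cast; ring
    have e2 : G = (G ^ (2 : ℝ)⁻¹) ^ 2 := by
      rw [← Real.rpow_natCast, ← Real.rpow_mul hG0]; norm_num
    rw [e1, e2, ← mul_pow]
    exact pow_le_pow_left₀ (by positivity) key 2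
  rw [div_mul_eq_mul_div, one_mul, div_le_iff₀ (by positivity)]
  nlinarith

lemma aux_int_scale {n : ℕ} (f : EuclideanSpace ℝ (Fin n) → ℝ) (x₀ : EuclideanSpace ℝ (Fin n))
    {ε : ℝ} (hε : 0 < ε) : ∫ x, f (ε⁻¹ • (x - x₀)) = ε ^ n * ∫ x, f x := by
  rw [integral_sub_right_eq_self (fun x => f (ε⁻¹ • x)) x₀, Measure.integral_comp_inv_smul]
  simp [abs_of_pos hε]

lemma aux_scale {n : ℕ} {v : EuclideanSpace ℝ (Fin n) → ℝ} (hv : IsTestFun Set.univ v)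
    (hv0 : v ≠ 0) {p : ℝ} (x₀ : EuclideanSpace ℝ (Fin n)) {δ : ℝ} (hδ : 0 < δ) :
    ∀ᶠ ε in nhdsWithin (0 : ℝ) (Set.Ioi 0), ∃ u : EuclideanSpace ℝ (Fin n) → ℝ,
      IsTestFun (Metric.ball x₀ δ) u ∧ u ≠ 0 ∧
      (∫ x, ‖gradient u x‖ ^ 2) = ε⁻¹ ^ 2 * (ε ^ n * ∫ x, ‖gradient v x‖ ^ 2) ∧
      (∫ x, u x ^ 2) = ε ^ n * (∫ x, v x ^ 2) ∧
      (∫ x, |u x| ^ p) = ε ^ n * (∫ x, |v x| ^ p) := by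
  obtain ⟨R, hR⟩ := hv.2.1.isCompact.isBounded.subset_closedBall (0 : EuclideanSpace ℝ (Fin n))
  have h1 : ∀ᶠ ε in nhdsWithin (0 : ℝ) (Set.Ioi 0), ε * R < δ := by
    refine Filter.Tendsto.eventually_lt_const hδ ?_
    have : Filter.Tendsto (fun ε : ℝ => ε * R) (nhds 0) (nhds (0 * R)) :=
      (continuous_id.mul continuous_const).tendsto 0
    rw [zero_mul] at this
    exact this.mono_left nhdsWithin_le_nhds
  filter_upwards [h1, self_mem_nhdsWithin] with ε h1 hε
  have hε : 0 < ε := hε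
  have hsupp : ∀ x ∉ Metric.closedBall x₀ (ε * R), v (ε⁻¹ • (x - x₀)) = 0 := by
    intro x hx
    apply image_eq_zero_of_notMem_tsupport
    intro h
    apply hx
    have := hR h
    rw [mem_closedBall_zero_iff, norm_smul, Real.norm_eq_abs, abs_of_pos (inv_pos.2 hε),
      inv_mul_le_iff₀ hε] at this
    rwa [mem_closedBall_iff_norm]
  refine ⟨fun x => v (ε⁻¹ • (x - x₀)), ⟨?_, ?_, ?_⟩, ?_, ?_, ?_, ?_⟩
  · exact hv.1.comp (f := fun x => ε⁻¹ • (x - x₀)) (by fun_prop)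
  · exact HasCompactSupport.intro (isCompact_closedBall _ _) hsupp
  · refine (closure_minimal ?_ Metric.isClosed_closedBall).trans (Metric.closedBall_subset_ball h1)
    intro x hx
    by_contra h
    exact hx (hsupp x h)
  · obtain ⟨y, hy⟩ := Function.ne_iff.1 hv0
    refine Function.ne_iff.2 ⟨x₀ + ε • y, ?_⟩
    simpa [smul_smul, inv_mul_cancel₀ hε.ne'] using hy
  · rw [← aux_int_scale _ x₀ hε, ← integral_const_mul]
    congr 1
    ext x
    rw [aux_norm_grad, aux_norm_grad]
    have := fderiv_comp_sub (𝕜 := ℝ) (f := fun y => v (ε⁻¹ • y)) (x := x) x₀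
    rw [this, fderiv_comp_smul, norm_smul, Real.norm_eq_abs, abs_of_pos (inv_pos.2 hε), mul_pow]
  · exact aux_int_scale (fun x => v x ^ 2) x₀ hε
  · exact aux_int_scale (fun x => |v x| ^ p) x₀ hε

lemma aux_exists {n : ℕ} {Θ : Set (EuclideanSpace ℝ (Fin n))} (hΘo : IsOpen Θ)
    (hΘne : Θ.Nonempty) : ∃ u : EuclideanSpace ℝ (Fin n) → ℝ, IsTestFun Θ u ∧ u ≠ 0 := by
  obtain ⟨x, hx⟩ := hΘne
  obtain ⟨f, h1, h2, h3, -, h5⟩ := exists_contDiff_tsupport_subset (n := ⊤) (hΘo.mem_nhds hx)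
  refine ⟨f, ⟨h3, h2, h1⟩, fun h => ?_⟩
  simp [h] at h5

set_option maxHeartbeats 2000000 in
/-- with `λ₁` the first eigenvalue and `ℓ_λ` the ground-state level
(defined via infima over nonzero test functions), for every `λ < λ₁` one has
`0 < ℓ_λ ≤ κ^{a,c}`, and `λ ↦ ℓ_λ` is nonincreasing on `(−∞, λ₁)`. -/
theorem stmt_7 (n : ℕ) (hn : 3 ≤ n) (p : ℝ) (hp : p = 2 * (n : ℝ) / ((n : ℝ) - 2))
    (Θ : Set (EuclideanSpace ℝ (Fin n))) (hΘne : Θ.Nonempty) (hΘo : IsOpen Θ)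
    (hΘb : Bornology.IsBounded Θ)
    (a b c : EuclideanSpace ℝ (Fin n) → ℝ)
    (ha : ContDiffOn ℝ 1 a (closure Θ)) (hb : ContinuousOn b (closure Θ))
    (hc : ContinuousOn c (closure Θ))
    (hapos : ∀ x ∈ closure Θ, 0 < a x) (hbpos : ∀ x ∈ closure Θ, 0 < b x)
    (hcpos : ∀ x ∈ closure Θ, 0 < c x)
    (κ : ℝ)
    (hκ : κ = sInf ((fun x => a x ^ ((n : ℝ) / 2) / c x ^ (((n : ℝ) - 2) / 2)) '' closure Θ) *
          ((1 : ℝ) / n) * SobolevS n ^ ((n : ℝ) / 2))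
    (lam₁ : ℝ)
    (hlam₁ : lam₁ = sInf { r : ℝ | ∃ u : EuclideanSpace ℝ (Fin n) → ℝ,
      IsTestFun Θ u ∧ u ≠ 0 ∧
      r = (∫ x in Θ, a x * ‖gradient u x‖ ^ 2) / ∫ x in Θ, b x * u x ^ 2 })
    (ℓ : ℝ → ℝ)
    (hℓ : ∀ lam : ℝ, ℓ lam = sInf { r : ℝ | ∃ u : EuclideanSpace ℝ (Fin n) → ℝ,
      IsTestFun Θ u ∧ u ≠ 0 ∧
      r = (1 : ℝ) / n *
        (((∫ x in Θ, a x * ‖gradient u x‖ ^ 2) - lam * ∫ x in Θ, b x * u x ^ 2) /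
            (∫ x in Θ, c x * |u x| ^ p) ^ (2 / p)) ^ ((n : ℝ) / 2) }) :
    (∀ lam : ℝ, lam < lam₁ → 0 < ℓ lam ∧ ℓ lam ≤ κ) ∧
    (∀ lam μ : ℝ, lam ≤ μ → μ < lam₁ → ℓ μ ≤ ℓ lam) := by
  have hn' : (3 : ℝ) ≤ n := by exact_mod_cast hn
  have hp0 : 0 < p := by rw [hp]; apply div_pos <;> linarith
  have hn2 : (n : ℝ) - 2 ≠ 0 := by linarith
  have hn0 : (n : ℝ) ≠ 0 := by linarith
  have hnpos : (0 : ℝ) < n := by linarith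
  have hnh : (0 : ℝ) < (n : ℝ) / 2 := by linarith
  have hq0 : 0 < 2 / p := by positivity
  have hqn : 2 / p * n = n - 2 := by rw [hp]; field_simp
  have hqn2 : 2 / p * (n / 2) = (n - 2) / 2 := by rw [hp]; field_simp
  have hK : IsCompact (closure Θ) := hΘb.isCompact_closure
  have hac : ContinuousOn a (closure Θ) := ha.continuousOn
  have hKne : (closure Θ).Nonempty := hΘne.closure
  obtain ⟨xa, hxa, hxa'⟩ := hK.exists_isMinOn hKne hac
  obtain ⟨xb, hxb, hxb'⟩ := hK.exists_isMinOn hKne hb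
  obtain ⟨xc, hxc, hxc'⟩ := hK.exists_isMinOn hKne hc
  obtain ⟨xC, hxC, hxC'⟩ := hK.exists_isMaxOn hKne hc
  have za : ∀ {u : EuclideanSpace ℝ (Fin n) → ℝ}, IsTestFun Θ u → ∀ x ∉ Θ, ‖gradient u x‖ ^ 2 = 0 :=
    fun hu x hx => (aux_grad hu).2 x fun h => hx (hu.2.2 h)
  have zb : ∀ {u : EuclideanSpace ℝ (Fin n) → ℝ}, IsTestFun Θ u → ∀ x ∉ Θ, u x ^ 2 = 0 :=
    fun hu x hx => (aux_sq hu).2 x fun h => hx (hu.2.2 h)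
  have zc : ∀ {u : EuclideanSpace ℝ (Fin n) → ℝ}, IsTestFun Θ u → ∀ x ∉ Θ, |u x| ^ p = 0 :=
    fun hu x hx => (aux_pow hu hp0).2 x fun h => hx (hu.2.2 h)
  have wA := fun {u : EuclideanSpace ℝ (Fin n) → ℝ} (hu : IsTestFun Θ u) =>
    aux_weight hΘo hΘb hac (aux_grad hu).1 (fun x => by positivity) (za hu)
  have wB := fun {u : EuclideanSpace ℝ (Fin n) → ℝ} (hu : IsTestFun Θ u) =>
    aux_weight hΘo hΘb hb (aux_sq hu).1 (fun x => by positivity) (zb hu)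
  have wC := fun {u : EuclideanSpace ℝ (Fin n) → ℝ} (hu : IsTestFun Θ u) =>
    aux_weight hΘo hΘb hc (aux_pow hu hp0).1 (fun x => by positivity) (zc hu)
  have lA : ∀ {u : EuclideanSpace ℝ (Fin n) → ℝ}, IsTestFun Θ u →
      a xa * ∫ x, ‖gradient u x‖ ^ 2 ≤ ∫ x in Θ, a x * ‖gradient u x‖ ^ 2 :=
    fun hu => (wA hu).2 _ fun x hx _ => hxa' (subset_closure hx)
  have pG : ∀ u : EuclideanSpace ℝ (Fin n) → ℝ, 0 ≤ ∫ x, ‖gradient u x‖ ^ 2 :=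
    fun u => integral_nonneg fun x => by positivity
  have pA : ∀ {u : EuclideanSpace ℝ (Fin n) → ℝ}, IsTestFun Θ u →
      0 ≤ ∫ x in Θ, a x * ‖gradient u x‖ ^ 2 :=
    fun hu => (mul_nonneg (hapos xa hxa).le (pG _)).trans (lA hu)
  have pB : ∀ {u : EuclideanSpace ℝ (Fin n) → ℝ}, IsTestFun Θ u → u ≠ 0 →
      0 < ∫ x in Θ, b x * u x ^ 2 :=
    fun hu hu0 => (mul_pos (hbpos xb hxb) (aux_int_pos hu hu0 hp0).1).trans_le
      ((wB hu).2 _ fun x hx _ => hxb' (subset_closure hx))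
  have pC : ∀ {u : EuclideanSpace ℝ (Fin n) → ℝ}, IsTestFun Θ u → u ≠ 0 →
      0 < ∫ x in Θ, c x * |u x| ^ p :=
    fun hu hu0 => (mul_pos (hcpos xc hxc) (aux_int_pos hu hu0 hp0).2).trans_le
      ((wC hu).2 _ fun x hx _ => hxc' (subset_closure hx))
  have hlamle : ∀ {u : EuclideanSpace ℝ (Fin n) → ℝ}, IsTestFun Θ u → u ≠ 0 →
      lam₁ * ∫ x in Θ, b x * u x ^ 2 ≤ ∫ x in Θ, a x * ‖gradient u x‖ ^ 2 := by
    intro u hu hu0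
    rw [← le_div_iff₀ (pB hu hu0), hlam₁]
    refine csInf_le ⟨0, ?_⟩ ⟨u, hu, hu0, rfl⟩
    rintro r ⟨w, hw, hw0, rfl⟩
    exact div_nonneg (pA hw) (pB hw hw0).le
  have hcoer : ∀ lam, lam < lam₁ → ∃ d : ℝ, 0 < d ∧
      ∀ u : EuclideanSpace ℝ (Fin n) → ℝ, IsTestFun Θ u → u ≠ 0 →
      d * (∫ x in Θ, a x * ‖gradient u x‖ ^ 2) ≤
        (∫ x in Θ, a x * ‖gradient u x‖ ^ 2) - lam * ∫ x in Θ, b x * u x ^ 2 := by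
    intro lam hlam
    rcases le_or_gt lam 0 with h | h
    · refine ⟨1, one_pos, fun u hu hu0 => ?_⟩
      have := mul_nonneg (neg_nonneg.2 h) (pB hu hu0).le
      linarith
    · have h1 : 0 < lam₁ := h.trans hlam
      refine ⟨1 - lam / lam₁, sub_pos.2 ((div_lt_one h1).2 hlam), fun u hu hu0 => ?_⟩
      have h2 := mul_le_mul_of_nonneg_left (hlamle hu hu0) (div_pos h h1).le
      rw [← mul_assoc, div_mul_cancel₀ _ h1.ne'] at h2
      linarith
  have pN : ∀ {lam}, lam < lam₁ → ∀ {u : EuclideanSpace ℝ (Fin n) → ℝ}, IsTestFun Θ u → u ≠ 0 →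
      0 ≤ (∫ x in Θ, a x * ‖gradient u x‖ ^ 2) - lam * ∫ x in Θ, b x * u x ^ 2 := by
    intro lam hlam u hu hu0
    obtain ⟨d, hd, h⟩ := hcoer lam hlam
    exact (mul_nonneg hd.le (pA hu)).trans (h u hu hu0)
  have hle : ∀ {lam}, lam < lam₁ → ∀ {u : EuclideanSpace ℝ (Fin n) → ℝ}, IsTestFun Θ u → u ≠ 0 →
      ℓ lam ≤ (1 : ℝ) / n *
        (((∫ x in Θ, a x * ‖gradient u x‖ ^ 2) - lam * ∫ x in Θ, b x * u x ^ 2) /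
            (∫ x in Θ, c x * |u x| ^ p) ^ (2 / p)) ^ ((n : ℝ) / 2) := by
    intro lam hlam u hu hu0
    rw [hℓ]
    refine csInf_le ⟨0, ?_⟩ ⟨u, hu, hu0, rfl⟩
    rintro r ⟨w, hw, hw0, rfl⟩
    have := pN hlam hw hw0
    have := pC hw hw0
    positivity
  obtain ⟨u₀, hu₀, hu₀0⟩ := aux_exists hΘo hΘne
  refine ⟨fun lam hlam => ⟨?_, ?_⟩, fun lam μ hlm hμ => ?_⟩
  · -- positivity
    obtain ⟨d, hd, h⟩ := hcoer lam hlam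
    obtain ⟨K, hK0, hKs⟩ := aux_sobolev n hn p hp
    have hca := hapos xa hxa
    have hcC := hcpos xC hxC
    have hm : 0 < (1 : ℝ) / n * (d * a xa * K / c xC ^ (2 / p)) ^ ((n : ℝ) / 2) := by positivity
    refine hm.trans_le ?_
    rw [hℓ]
    refine le_csInf ⟨_, u₀, hu₀, hu₀0, rfl⟩ ?_
    rintro r ⟨u, hu, hu0, rfl⟩
    have hC1 : ∫ x in Θ, c x * |u x| ^ p ≤ c xC * ∫ x, |u x| ^ p :=
      (wC hu).1 _ fun x hx _ => hxC' (subset_closure hx)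
    have hP := (aux_int_pos hu hu0 hp0).2
    have hC2 : (∫ x in Θ, c x * |u x| ^ p) ^ (2 / p) ≤ c xC ^ (2 / p) * (∫ x, |u x| ^ p) ^ (2 / p) := by
      rw [← Real.mul_rpow hcC.le hP.le]
      exact Real.rpow_le_rpow (pC hu hu0).le hC1 hq0.le
    have hS := hKs u ⟨hu.1, hu.2.1, Set.subset_univ _⟩
    refine mul_le_mul_of_nonneg_left (Real.rpow_le_rpow (by positivity) ?_ hnh.le) (by positivity)
    have hCp := Real.rpow_pos_of_pos (pC hu hu0) (2 / p)
    rw [le_div_iff₀ hCp]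
    calc d * a xa * K / c xC ^ (2 / p) * (∫ x in Θ, c x * |u x| ^ p) ^ (2 / p)
        ≤ d * a xa * K / c xC ^ (2 / p) * (c xC ^ (2 / p) * (∫ x, |u x| ^ p) ^ (2 / p)) := by gcongr
      _ = d * (a xa * (K * (∫ x, |u x| ^ p) ^ (2 / p))) := by
          have := (Real.rpow_pos_of_pos hcC (2 / p)).ne'
          field_simp
      _ ≤ d * (a xa * ∫ x, ‖gradient u x‖ ^ 2) := by gcongr
      _ ≤ d * ∫ x in Θ, a x * ‖gradient u x‖ ^ 2 := by gcongr; exact lA hu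
      _ ≤ _ := h u hu hu0
  · -- upper bound
    have step1 : ∀ x₀ ∈ Θ, ∀ v : EuclideanSpace ℝ (Fin n) → ℝ, IsTestFun Set.univ v → v ≠ 0 →
        ℓ lam ≤ 1 / n * (a x₀ * (∫ x, ‖gradient v x‖ ^ 2) /
          (c x₀ * ∫ x, |v x| ^ p) ^ (2 / p)) ^ ((n : ℝ) / 2) := by
      intro x₀ hx₀ v hv hv0
      have hc0 := hcpos x₀ (subset_closure hx₀)
      have ha0 := hapos x₀ (subset_closure hx₀)
      have hb0 := hbpos x₀ (subset_closure hx₀)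
      obtain ⟨hM, hP⟩ := aux_int_pos hv hv0 hp0
      have hG := pG v
      set G := ∫ x, ‖gradient v x‖ ^ 2
      set M := ∫ x, v x ^ 2
      set P := ∫ x, |v x| ^ p
      have hcP : c x₀ * P ≠ 0 := (mul_pos hc0 hP).ne'
      have hlim : Filter.Tendsto (fun η : ℝ => 1 / (n : ℝ) *
          (((a x₀ + η) * G + |lam| * ((b x₀ + η) * (η * M))) /
            ((c x₀ - η) * P) ^ (2 / p)) ^ ((n : ℝ) / 2)) (nhdsWithin 0 (Set.Ioi 0))
          (nhds (1 / n * (a x₀ * G / (c x₀ * P) ^ (2 / p)) ^ ((n : ℝ) / 2))) := by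
        have hcont : ContinuousAt (fun η : ℝ => 1 / (n : ℝ) *
          (((a x₀ + η) * G + |lam| * ((b x₀ + η) * (η * M))) /
            ((c x₀ - η) * P) ^ (2 / p)) ^ ((n : ℝ) / 2)) 0 := by
          refine continuousAt_const.mul (ContinuousAt.rpow_const (ContinuousAt.div (by fun_prop)
            (ContinuousAt.rpow_const (by fun_prop) (Or.inr hq0.le)) ?_) (Or.inr hnh.le))
          rw [sub_zero]
          exact (Real.rpow_pos_of_pos (mul_pos hc0 hP) _).ne'
        have := hcont.tendsto
        simp only [add_zero, sub_zero, zero_mul, mul_zero] at this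
        exact this.mono_left nhdsWithin_le_nhds
      refine ge_of_tendsto hlim ?_
      filter_upwards [Ioo_mem_nhdsGT hc0] with η hη
      have hη0 : 0 < η := hη.1
      have hηc : 0 < c x₀ - η := sub_pos.2 hη.2
      have hΘn : Θ ∈ nhds x₀ := hΘo.mem_nhds hx₀
      have hcl : closure Θ ∈ nhds x₀ := Filter.mem_of_superset hΘn subset_closure
      have hev : ∀ᶠ x in nhds x₀, x ∈ Θ ∧ a x < a x₀ + η ∧ b x < b x₀ + η ∧ c x₀ - η < c x :=
        (Filter.eventually_of_mem hΘn fun x hx => hx).and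
          (((hac.continuousAt hcl).eventually_lt_const (by linarith)).and
          (((hb.continuousAt hcl).eventually_lt_const (by linarith)).and
          ((hc.continuousAt hcl).eventually_const_lt (by linarith))))
      obtain ⟨δ, hδ, hball⟩ := Metric.eventually_nhds_iff_ball.1 hev
      have hsq : ∀ᶠ ε in nhdsWithin (0 : ℝ) (Set.Ioi 0), ε ^ 2 < η := by
        refine Filter.Tendsto.eventually_lt_const hη0 ?_
        have : Filter.Tendsto (fun ε : ℝ => ε ^ 2) (nhds 0) (nhds (0 ^ 2)) :=
          (continuous_pow 2).tendsto 0
        rw [zero_pow two_ne_zero] at this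
        exact this.mono_left nhdsWithin_le_nhds
      obtain ⟨ε, ⟨u, hu, hu0, eG, eM, eP⟩, hε2, hε⟩ :=
        ((aux_scale hv hv0 (p := p) x₀ hδ).and (hsq.and self_mem_nhdsWithin)).exists
      have hε : 0 < ε := hε
      have huΘ : IsTestFun Θ u := ⟨hu.1, hu.2.1, hu.2.2.trans fun x hx => (hball x hx).1⟩
      have hA : ∫ x in Θ, a x * ‖gradient u x‖ ^ 2 ≤ (a x₀ + η) * (ε⁻¹ ^ 2 * (ε ^ n * G)) := by
        rw [← eG]
        refine (wA huΘ).1 _ fun x _ hx => (hball x (hu.2.2 ?_)).2.1.le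
        by_contra h
        exact hx ((aux_grad hu).2 x h)
      have hB : ∫ x in Θ, b x * u x ^ 2 ≤ (b x₀ + η) * (ε ^ n * M) := by
        rw [← eM]
        refine (wB huΘ).1 _ fun x _ hx => (hball x (hu.2.2 ?_)).2.2.1.le
        by_contra h
        exact hx ((aux_sq hu).2 x h)
      have hC : (c x₀ - η) * (ε ^ n * P) ≤ ∫ x in Θ, c x * |u x| ^ p := by
        rw [← eP]
        refine (wC huΘ).2 _ fun x _ hx => (hball x (hu.2.2 ?_)).2.2.2.le
        by_contra h
        exact hx ((aux_pow hu hp0).2 x h)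
      have pBu := pB huΘ hu0
      have pCu := pC huΘ hu0
      refine (hle hlam huΘ hu0).trans ?_
      have hN0 := pN hlam huΘ hu0
      refine mul_le_mul_of_nonneg_left (Real.rpow_le_rpow (by positivity) ?_ hnh.le) (by positivity)
      have hεn : ((ε ^ n : ℝ)) ^ (2 / p) = ε⁻¹ ^ 2 * ε ^ n := by
        rw [← Real.rpow_natCast, ← Real.rpow_mul hε.le, mul_comm, hqn, Real.rpow_sub hε]
        simp [div_eq_mul_inv, mul_comm]
      have hCq : ε⁻¹ ^ 2 * ε ^ n * ((c x₀ - η) * P) ^ (2 / p) ≤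
          (∫ x in Θ, c x * |u x| ^ p) ^ (2 / p) := by
        rw [← hεn, ← Real.mul_rpow (by positivity) (by positivity)]
        refine Real.rpow_le_rpow (by positivity) ?_ hq0.le
        linarith
      have hNle : (∫ x in Θ, a x * ‖gradient u x‖ ^ 2) - lam * ∫ x in Θ, b x * u x ^ 2 ≤
          ε⁻¹ ^ 2 * ε ^ n * ((a x₀ + η) * G + |lam| * ((b x₀ + η) * (η * M))) := by
        have h1 : -lam * ∫ x in Θ, b x * u x ^ 2 ≤ |lam| * ((b x₀ + η) * (ε ^ n * M)) :=
          mul_le_mul (neg_le_abs lam) hB pBu.le (abs_nonneg _)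
        have h2 : ε ^ n ≤ ε⁻¹ ^ 2 * ε ^ n * η := by
          have : 1 ≤ ε⁻¹ ^ 2 * η := by
            rw [inv_pow, ← div_eq_inv_mul, one_le_div (by positivity)]
            exact hε2.le
          nlinarith [pow_pos hε n]
        have h3 : |lam| * ((b x₀ + η) * (ε ^ n * M)) ≤
            |lam| * ((b x₀ + η) * (ε⁻¹ ^ 2 * ε ^ n * η * M)) := by gcongr
        linarith
      have hz : 0 < ε⁻¹ ^ 2 * ε ^ n := by positivity
      calc _ ≤ (ε⁻¹ ^ 2 * ε ^ n * ((a x₀ + η) * G + |lam| * ((b x₀ + η) * (η * M)))) /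
            (ε⁻¹ ^ 2 * ε ^ n * ((c x₀ - η) * P) ^ (2 / p)) := by
              refine div_le_div₀ (by positivity) hNle (by positivity) hCq
        _ = _ := mul_div_mul_left _ _ hz.ne'
    have hfe : ∀ x ∈ closure Θ, ∀ t : ℝ, 0 ≤ t → (a x / c x ^ (2 / p) * t) ^ ((n : ℝ) / 2) =
        a x ^ ((n : ℝ) / 2) / c x ^ (((n : ℝ) - 2) / 2) * t ^ ((n : ℝ) / 2) := by
      intro x hx t ht
      have h1 := hapos x hx
      have h2 := hcpos x hx
      rw [Real.mul_rpow (by positivity) ht, Real.div_rpow h1.le (by positivity),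
        ← Real.rpow_mul h2.le, hqn2]
    have hS0 : 0 ≤ SobolevS n := by
      apply Real.sInf_nonneg
      rintro r ⟨u, hu, hu0, rfl⟩
      exact div_nonneg (pG u) (Real.rpow_nonneg (integral_nonneg fun x => by positivity) _)
    have step2 : ∀ x₀ ∈ Θ, ℓ lam ≤
        1 / n * (a x₀ / c x₀ ^ (2 / p) * SobolevS n) ^ ((n : ℝ) / 2) := by
      intro x₀ hx₀
      have hclosed : IsClosed {t : ℝ | ℓ lam ≤
          1 / n * (a x₀ / c x₀ ^ (2 / p) * t) ^ ((n : ℝ) / 2)} := by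
        refine isClosed_le continuous_const (continuous_const.mul
          (Continuous.rpow_const (by fun_prop) fun t => Or.inr hnh.le))
      refine closure_minimal ?_ hclosed (csInf_mem_closure
        ⟨_, u₀, ⟨hu₀.1, hu₀.2.1, Set.subset_univ _⟩, hu₀0, rfl⟩ ⟨0, ?_⟩)
      · rintro r ⟨v, hv, hv0, rfl⟩
        have := step1 x₀ hx₀ v hv hv0
        rw [Real.mul_rpow (hcpos x₀ (subset_closure hx₀)).le (aux_int_pos hv hv0 hp0).2.le,
          ← div_mul_div_comm] at this
        rw [← hp]
        exact this
      · rintro r ⟨u, hu, hu0, rfl⟩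
        exact div_nonneg (pG u) (Real.rpow_nonneg (integral_nonneg fun x => by positivity) _)
    have hfc : ContinuousOn (fun x => a x ^ ((n : ℝ) / 2) / c x ^ (((n : ℝ) - 2) / 2)) (closure Θ) := by
      refine ContinuousOn.div (hac.rpow_const fun x _ => Or.inr hnh.le)
        (hc.rpow_const fun x hx => Or.inl (hcpos x hx).ne') fun x hx => ?_
      exact (Real.rpow_pos_of_pos (hcpos x hx) _).ne'
    obtain ⟨y, hy, hy'⟩ := hK.exists_sInf_image_eq hKne hfc
    rw [hκ, hy']
    refine le_on_closure (s := Θ) (f := fun _ => ℓ lam)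
      (g := fun x => a x ^ ((n : ℝ) / 2) / c x ^ (((n : ℝ) - 2) / 2) * (1 / n) *
        SobolevS n ^ ((n : ℝ) / 2)) (fun x hx => ?_) continuousOn_const
      ((hfc.mul continuousOn_const).mul continuousOn_const) hy
    have := step2 x hx
    rw [hfe x (subset_closure hx) _ hS0] at this
    linarith
  · -- monotonicity
    rw [hℓ lam]
    refine le_csInf ⟨_, u₀, hu₀, hu₀0, rfl⟩ ?_
    rintro r ⟨u, hu, hu0, rfl⟩
    refine (hle hμ hu hu0).trans ?_
    have h1 := pN hμ hu hu0
    have h2 := pC hu hu0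
    have h3 := pB hu hu0
    refine mul_le_mul_of_nonneg_left (Real.rpow_le_rpow (by positivity) ?_ hnh.le) (by positivity)
    gcongr

end
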